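/- Let I be a maximal δ-ideal of k[X,1/det(X)], let k̃ be a finite Galois extension of k, and let ⟨I⟩_{k̃} = Q₁ ∩ ⋯ ∩ Q_s be the prime decomposition of ⟨I⟩_{k̃} in k̃[X,1/det(X)]. Then every Q_i is a δ-ideal, and {Q₁,…,Q_s} is the orbit of Q₁ under the action of Gal(k̃/k). -/

import Mathlib

open MvPolynomial Matrix

noncomputable section

/-- The `n × n` matrix of indeterminates `X = (X_{i,j})` over a field `K`. -/
def matX (K : Type) [Field K] (n : ℕ) :
    Matrix (Fin n) (Fin n) (MvPolynomial (Fin n × Fin n) K) :=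
  Matrix.of fun i j => X (i, j)

/-- The ring `K[X, 1/det(X)]`. -/
abbrev GLRing (K : Type) [Field K] (n : ℕ) := Localization.Away (matX K n).det

/-- The image of the matrix of indeterminates in `K[X, 1/det(X)]`. -/
def XX (K : Type) [Field K] (n : ℕ) : Matrix (Fin n) (Fin n) (GLRing K n) :=
  (matX K n).map (algebraMap _ _)

/-- The ideal `I(F,ν)` of `K[X,1/det(X)]` generated by the polynomials of total degree
at most `ν` vanishing at the fundamental matrix (encoded by the evaluation map `ev`). -/
def Ifv {K : Type} [Field K] {n : ℕ} {S : Type} [CommRing S]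
    (ev : GLRing K n → S) (ν : ℕ) : Ideal (GLRing K n) :=
  Ideal.span {q | ∃ P : MvPolynomial (Fin n × Fin n) K, P.totalDegree ≤ ν ∧
    ev (algebraMap (MvPolynomial (Fin n × Fin n) K) (GLRing K n) P) = 0 ∧
    q = algebraMap (MvPolynomial (Fin n × Fin n) K) (GLRing K n) P}

/-- The stabilizer `stab(I) = {g : ∀ P ∈ I, P(Xg) ∈ I}` of an ideal `I`, where
`σ g` is the substitution `P(X) ↦ P(Xg)`. -/
def stab {G R : Type} [CommRing R] (σ : G → R → R) (I : Ideal R) : Set G :=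
  {g | ∀ P ∈ I, σ g P ∈ I}

/-- The algebraic closure k̄ of k = C(t). -/
abbrev kbar (C : Type) [Field C] : Type := AlgebraicClosure (RatFunc C)

/-- `I` is a δ-ideal: δ(I) ⊆ I. -/
def IsDiffIdeal {R : Type} [CommRing R] (δ : R → R) (I : Ideal R) : Prop := ∀ x ∈ I, δ x ∈ I

/-- `I` is a maximal δ-ideal: a proper δ-ideal maximal among proper δ-ideals. -/
def IsMaxDiffIdeal {R : Type} [CommRing R] (δ : R → R) (I : Ideal R) : Prop :=
  I ≠ ⊤ ∧ IsDiffIdeal δ I ∧ ∀ J : Ideal R, J ≠ ⊤ → IsDiffIdeal δ J → I ≤ J → J = I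

section GLRing

variable {K : Type} [Field K] {n : ℕ}

theorem XX_apply (i j : Fin n) :
    XX K n i j = algebraMap (MvPolynomial (Fin n × Fin n) K) (GLRing K n) (X (i, j)) := rfl

theorem GLRing.algebraMap_eq (a : K) :
    algebraMap K (GLRing K n) a =
      algebraMap (MvPolynomial (Fin n × Fin n) K) (GLRing K n) (MvPolynomial.C a) := by
  rw [IsScalarTower.algebraMap_apply K (MvPolynomial (Fin n × Fin n) K) (GLRing K n)]
  rfl

theorem GLRing.ringHom_ext {S : Type} [CommRing S] {f g : GLRing K n →+* S}
    (hc : ∀ a : K, f (algebraMap K (GLRing K n) a) = g (algebraMap K (GLRing K n) a))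
    (hX : ∀ i j, f (XX K n i j) = g (XX K n i j)) : f = g := by
  refine IsLocalization.ringHom_ext (Submonoid.powers (matX K n).det) ?_
  refine MvPolynomial.ringHom_ext (fun a => ?_) fun ij => hX ij.1 ij.2
  simpa only [GLRing.algebraMap_eq, RingHom.comp_apply] using hc a

/-- Two additive maps satisfying the Leibniz rule along the same ring homomorphism agree as soon
as they agree on the constants and on the indeterminates. -/
theorem GLRing.leibniz_ext {S : Type} [CommRing S] (φ : GLRing K n →+* S)
    (D E : GLRing K n →+ S)
    (hD : ∀ x y, D (x * y) = φ x * D y + φ y * D x)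
    (hE : ∀ x y, E (x * y) = φ x * E y + φ y * E x)
    (hc : ∀ a : K, D (algebraMap K (GLRing K n) a) = E (algebraMap K (GLRing K n) a))
    (hX : ∀ i j, D (XX K n i j) = E (XX K n i j)) (x : GLRing K n) : D x = E x := by
  have key : ∀ p : MvPolynomial (Fin n × Fin n) K,
      D (algebraMap _ (GLRing K n) p) = E (algebraMap _ (GLRing K n) p) := by
    intro p
    induction p using MvPolynomial.induction_on with
    | C a => simpa only [GLRing.algebraMap_eq] using hc a
    | add p q hp hq => rw [map_add, map_add, map_add, hp, hq]
    | mul_X p ij hp => rw [map_mul, hD, hE, hp, ← XX_apply, hX]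
  obtain ⟨⟨p, d⟩, h⟩ := IsLocalization.surj (Submonoid.powers (matX K n).det) x
  have hu : IsUnit (φ (algebraMap _ (GLRing K n) (d : MvPolynomial (Fin n × Fin n) K))) :=
    (IsLocalization.map_units (GLRing K n) d).map φ
  have h₁ := key p
  rw [← h, hD, hE, key] at h₁
  exact hu.mul_left_cancel (add_left_cancel h₁)

theorem powers_det_matX_le_nonZeroDivisors :
    Submonoid.powers (matX K n).det ≤ nonZeroDivisors (MvPolynomial (Fin n × Fin n) K) := by
  refine powers_le_nonZeroDivisors_of_noZeroDivisors ?_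
  exact Matrix.det_mvPolynomialX_ne_zero (Fin n) K

theorem GLRing.map_algebraMap {L : Type} [Field L] (f : GLRing K n →+* GLRing L n) (σ : K →+* L)
    (hX : ∀ i j, f (XX K n i j) = XX L n i j)
    (hc : ∀ a : K, f (algebraMap K (GLRing K n) a) = algebraMap L (GLRing L n) (σ a))
    (p : MvPolynomial (Fin n × Fin n) K) :
    f (algebraMap _ (GLRing K n) p) =
      algebraMap _ (GLRing L n) (MvPolynomial.map σ p) := by
  suffices h : f.comp (algebraMap _ (GLRing K n)) =
      (algebraMap (MvPolynomial (Fin n × Fin n) L) (GLRing L n)).comp (MvPolynomial.map σ) from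
    congrArg (fun g => g p) h
  refine MvPolynomial.ringHom_ext (fun a => ?_) fun ij => ?_
  · simpa only [GLRing.algebraMap_eq, RingHom.comp_apply, MvPolynomial.map_C] using hc a
  · simpa only [XX_apply, RingHom.comp_apply, MvPolynomial.map_X] using hX ij.1 ij.2

theorem map_det_matX {L : Type} [Field L] (σ : K →+* L) :
    MvPolynomial.map σ (matX K n).det = (matX L n).det := by
  rw [RingHom.map_det]
  congr 1
  refine Matrix.ext fun i j => ?_
  exact MvPolynomial.map_X σ (i, j)

/-- An element of `L[X,1/det(X)]` fixed by the Galois group of `L/K` comes from `K[X,1/det(X)]`. -/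
theorem GLRing.mem_range_of_fixed {L : Type} [Field L] [Algebra K L] [FiniteDimensional K L]
    [IsGalois K L]
    (act : (L ≃ₐ[K] L) → (GLRing L n →+* GLRing L n))
    (hactX : ∀ ρ i j, act ρ (XX L n i j) = XX L n i j)
    (hactc : ∀ ρ (a : L), act ρ (algebraMap L (GLRing L n) a) = algebraMap L (GLRing L n) (ρ a))
    (ι : GLRing K n →+* GLRing L n)
    (hιX : ∀ i j, ι (XX K n i j) = XX L n i j)
    (hιc : ∀ a : K, ι (algebraMap K (GLRing K n) a)
      = algebraMap L (GLRing L n) (algebraMap K L a))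
    (x : GLRing L n) (hx : ∀ ρ, act ρ x = x) : ∃ y, ι y = x := by
  have hact := fun ρ => GLRing.map_algebraMap (act ρ) (ρ : L →+* L) (hactX ρ) (hactc ρ)
  have hι := GLRing.map_algebraMap ι (algebraMap K L) hιX hιc
  have hinj : Function.Injective
      (algebraMap (MvPolynomial (Fin n × Fin n) L) (GLRing L n)) :=
    IsLocalization.injective _ powers_det_matX_le_nonZeroDivisors
  obtain ⟨⟨p, ⟨_, m, rfl⟩⟩, h⟩ := IsLocalization.surj (Submonoid.powers (matX L n).det) x
  simp only at h
  have hp : ∀ ρ : L ≃ₐ[K] L, MvPolynomial.map (ρ : L →+* L) p = p := by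
    intro ρ
    apply hinj
    rw [← hact, ← h, map_mul, hx, hact, map_pow, map_det_matX]
  have hcoeff : ∀ d, p.coeff d ∈ Set.range (algebraMap K L) := by
    intro d
    refine (IsGalois.mem_range_algebraMap_iff_fixed _).2 fun ρ => ?_
    have := congrArg (MvPolynomial.coeff d) (hp ρ)
    rwa [MvPolynomial.coeff_map] at this
  obtain ⟨q, hq⟩ : ∃ q, MvPolynomial.map (algebraMap K L) q = p := by
    refine MvPolynomial.mem_range_map_iff_coeffs_subset.2 ?_
    intro c hc
    obtain ⟨d, -, rfl⟩ := MvPolynomial.mem_coeffs_iff.1 hc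
    exact hcoeff d
  refine ⟨IsLocalization.mk' (GLRing K n) q
    (⟨(matX K n).det ^ m, m, rfl⟩ : Submonoid.powers (matX K n).det), ?_⟩
  have hu : IsUnit (algebraMap (MvPolynomial (Fin n × Fin n) L) (GLRing L n)
      ((matX L n).det ^ m)) :=
    IsLocalization.map_units (GLRing L n)
      (⟨(matX L n).det ^ m, m, rfl⟩ : Submonoid.powers (matX L n).det)
  refine hu.mul_right_cancel ?_
  have hdet : algebraMap (MvPolynomial (Fin n × Fin n) L) (GLRing L n) ((matX L n).det ^ m) =
      ι (algebraMap _ (GLRing K n) ((matX K n).det ^ m)) := by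
    rw [hι, map_pow (MvPolynomial.map _), map_det_matX]
  rw [h, ← hq, ← hι, hdet, ← map_mul]
  exact congrArg ι (IsLocalization.mk'_spec _ _ _)

end GLRing

/-- The ideal generated by the image of a differential ideal is a differential ideal. -/
theorem IsDiffIdeal.map {R S : Type} [CommRing R] [CommRing S] {I : Ideal R} (ι : R →+* S)
    (d : R → R) (D : S →+ S) (hD : ∀ x y, D (x * y) = x * D y + y * D x)
    (hι : ∀ x, D (ι x) = ι (d x)) (hI : IsDiffIdeal d I) : IsDiffIdeal D (I.map ι) := by
  intro x hx
  refine Submodule.span_induction (p := fun x _ => D x ∈ I.map ι) ?_ ?_ ?_ ?_ hx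
  · rintro _ ⟨y, hy, rfl⟩
    rw [hι]
    exact Ideal.mem_map_of_mem ι (hI y hy)
  · rw [map_zero]
    exact zero_mem _
  · intro x y _ _ hx hy
    rw [map_add]
    exact add_mem hx hy
  · intro a x hx hDx
    rw [smul_eq_mul, hD]
    exact add_mem (Ideal.mul_mem_left _ a hDx) (Ideal.mul_mem_right _ _ hx)

/-- If a differential ideal is a finite irredundant intersection of primes, then each of these
primes is a differential ideal. -/
theorem IsDiffIdeal.of_iInf_eq {S ι : Type} [CommRing S] [Finite ι] {J : Ideal S} {Q : ι → Ideal S}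
    (hQ : ∀ i, (Q i).IsPrime) (hirr : ∀ i j, Q i ≤ Q j → i = j) (hJ : ⨅ i, Q i = J)
    (D : S → S) (hD : ∀ x y, D (x * y) = x * D y + y * D x) (hJD : IsDiffIdeal D J) (i : ι) :
    IsDiffIdeal D (Q i) := by
  classical
  have := Fintype.ofFinite ι
  obtain ⟨y, hy, hyi⟩ : ∃ y ∈ (Finset.univ.erase i).inf Q, y ∉ Q i := by
    refine SetLike.not_le_iff_exists.1 fun hle => ?_
    obtain ⟨j, hj, hji⟩ := ((hQ i).inf_le').1 hle
    exact Finset.ne_of_mem_erase hj (hirr j i hji)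
  intro x hx
  have hxy : x * y ∈ J := by
    rw [← hJ, Ideal.mem_iInf]
    intro j
    by_cases hji : j = i
    · exact hji ▸ Ideal.mul_mem_right y _ hx
    · refine Ideal.mul_mem_left _ x ?_
      exact Finset.inf_le (f := Q) (Finset.mem_erase.2 ⟨hji, Finset.mem_univ j⟩) hy
  have h := hJ.symm.le.trans (iInf_le Q i) (hJD _ hxy)
  rw [hD, (Q i).add_mem_iff_right (Ideal.mul_mem_right _ _ hx)] at h
  exact ((hQ i).mem_or_mem h).resolve_left hyi

/-- A finite group acting on `S` with all invariants in the image of `R` acts transitively on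
primes with a given contraction, in the form of an inclusion. -/
theorem exists_le_comap_of_comap_eq {R S G : Type} [CommRing R] [CommRing S] [Group G] [Finite G]
    (act : G → (S →+* S)) (hone : act 1 = RingHom.id S)
    (hmul : ∀ g h, (act g).comp (act h) = act (g * h)) (ι : R →+* S)
    (hfix : ∀ x, (∀ g, act g x = x) → ∃ y, ι y = x) {P Q : Ideal S} [P.IsPrime] [Q.IsPrime]
    (h : P.comap ι = Q.comap ι) : ∃ g, P ≤ Q.comap (act g) := by
  classical
  have := Fintype.ofFinite G
  have hsub : (P : Set S) ⊆ ⋃ g ∈ ((Finset.univ : Finset G) : Set G), Q.comap (act g) := by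
    intro x hx
    obtain ⟨y, hy⟩ : ∃ y, ι y = ∏ g, act g x := by
      refine hfix _ fun g => ?_
      rw [map_prod]
      exact Fintype.prod_equiv (Equiv.mulLeft g) _ _ fun a =>
        congrArg (fun f => f x) (hmul g a)
    have hP : ∏ g, act g x ∈ P := by
      refine Ideal.mem_of_dvd _ (Finset.dvd_prod_of_mem _ (Finset.mem_univ (1 : G))) ?_
      rwa [hone]
    have hQ : ∏ g, act g x ∈ Q := by
      rw [← hy] at hP ⊢
      exact h.le hP
    obtain ⟨g, -, hg⟩ := (Ideal.IsPrime.prod_mem_iff).1 hQ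
    exact Set.mem_biUnion (Finset.mem_coe.2 (Finset.mem_univ g)) hg
  obtain ⟨g, -, hg⟩ := (Ideal.subset_union_prime 1 1 fun g _ _ _ => inferInstance).1 hsub
  exact ⟨g, hg⟩

set_option synthInstance.maxHeartbeats 1000000
set_option maxHeartbeats 4000000

theorem statement15
    (C : Type) [Field C] [IsAlgClosed C] [CharZero C]
    (n : ℕ)
    -- the derivation δ = d/dt on k = C(t)
    (dk : Derivation C (RatFunc C) (RatFunc C)) (hdk : dk RatFunc.X = 1)
    (A : Matrix (Fin n) (Fin n) (RatFunc C))
    -- the derivation on k[X,1/det(X)] extending δ with δ(X) = AX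
    (dR : Derivation C (GLRing (RatFunc C) n) (GLRing (RatFunc C) n))
    (hdRk : ∀ a : RatFunc C, dR (algebraMap (RatFunc C) (GLRing (RatFunc C) n) a)
      = algebraMap (RatFunc C) (GLRing (RatFunc C) n) (dk a))
    (hdRX : ∀ i j, dR (XX (RatFunc C) n i j)
      = (A.map (algebraMap (RatFunc C) (GLRing (RatFunc C) n)) * XX (RatFunc C) n) i j)
    -- k̃ : a finite Galois extension of k inside k̄
    (kt : IntermediateField (RatFunc C) (kbar C))
    [FiniteDimensional (RatFunc C) ↥kt] [IsGalois (RatFunc C) ↥kt]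
    -- the derivation on k̃ extending δ, and on k̃[X,1/det(X)] with δ(X) = AX
    (dkt : Derivation C (↥kt) (↥kt))
    (hdkt : ∀ a : RatFunc C, dkt (algebraMap (RatFunc C) (↥kt) a)
      = algebraMap (RatFunc C) (↥kt) (dk a))
    (dGt : Derivation C (GLRing (↥kt) n) (GLRing (↥kt) n))
    (hdGtc : ∀ a : ↥kt, dGt (algebraMap (↥kt) (GLRing (↥kt) n) a)
      = algebraMap (↥kt) (GLRing (↥kt) n) (dkt a))
    (hdGtX : ∀ i j, dGt (XX (↥kt) n i j)
      = ((A.map (fun a => algebraMap (↥kt) (GLRing (↥kt) n)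
          (algebraMap (RatFunc C) (↥kt) a))) * XX (↥kt) n) i j)
    -- the action of Gal(k̃/k) on k̃[X,1/det(X)] through the coefficients
    (act : (↥kt ≃ₐ[RatFunc C] ↥kt) → (GLRing (↥kt) n →+* GLRing (↥kt) n))
    (hactX : ∀ ρ i j, act ρ (XX (↥kt) n i j) = XX (↥kt) n i j)
    (hactc : ∀ ρ (a : ↥kt), act ρ (algebraMap (↥kt) (GLRing (↥kt) n) a)
      = algebraMap (↥kt) (GLRing (↥kt) n) (ρ a))
    -- the inclusion k[X,1/det(X)] → k̃[X,1/det(X)]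
    (ι : GLRing (RatFunc C) n →+* GLRing (↥kt) n)
    (hιX : ∀ i j, ι (XX (RatFunc C) n i j) = XX (↥kt) n i j)
    (hιc : ∀ a : RatFunc C, ι (algebraMap (RatFunc C) (GLRing (RatFunc C) n) a)
      = algebraMap (↥kt) (GLRing (↥kt) n) (algebraMap (RatFunc C) (↥kt) a))
    -- I : a maximal δ-ideal of k[X,1/det(X)]
    (I : Ideal (GLRing (RatFunc C) n))
    (hI : IsMaxDiffIdeal (fun x => dR x) I)
    -- ⟨I⟩_{k̃} = Q₀ ∩ ⋯ ∩ Q_s : the prime decomposition of ⟨I⟩_{k̃}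
    (s : ℕ) (Q : Fin (s + 1) → Ideal (GLRing (↥kt) n))
    (hQprime : ∀ i, (Q i).IsPrime)
    (hQinj : Function.Injective Q)
    (hQmin : ∀ i, Q i ∈ (Ideal.map ι I).minimalPrimes)
    (hQdecomp : ⨅ i, Q i = Ideal.map ι I) :
    -- every Q_i is a δ-ideal ...
    (∀ i, ∀ x ∈ Q i, dGt x ∈ Q i)
    -- ... and {Q₀,…,Q_s} is the orbit of Q₀ under Gal(k̃/k)
    ∧ (∀ i, ∃ ρ : ↥kt ≃ₐ[RatFunc C] ↥kt, Q i = Ideal.map (act ρ) (Q 0))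
    ∧ (∀ ρ : ↥kt ≃ₐ[RatFunc C] ↥kt, ∃ i, Ideal.map (act ρ) (Q 0) = Q i) := by
  have hone : act 1 = RingHom.id _ :=
    GLRing.ringHom_ext (fun a => hactc 1 a) (fun i j => hactX 1 i j)
  have hmul : ∀ g h, (act g).comp (act h) = act (g * h) := fun g h =>
    GLRing.ringHom_ext
      (fun a => by rw [RingHom.comp_apply, hactc, hactc, hactc]; rfl)
      (fun i j => by rw [RingHom.comp_apply, hactX, hactX, hactX])
  have hactι : ∀ g, (act g).comp ι = ι := fun g =>
    GLRing.ringHom_ext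
      (fun a => by rw [RingHom.comp_apply, hιc, hactc, AlgEquiv.commutes])
      (fun i j => by rw [RingHom.comp_apply, hιX, hactX])
  have hmulx : ∀ g h x, act g (act h x) = act (g * h) x := fun g h x =>
    congrArg (fun f => f x) (hmul g h)
  have hinv₁ : ∀ g x, act g (act g⁻¹ x) = x := fun g x => by
    rw [hmulx, mul_inv_cancel, hone, RingHom.id_apply]
  have hinv₂ : ∀ g x, act g⁻¹ (act g x) = x := fun g x => by
    rw [hmulx, inv_mul_cancel, hone, RingHom.id_apply]
  have hmap : ∀ g (P : Ideal (GLRing (↥kt) n)), P.map (act g) = P.comap (act g⁻¹) := by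
    intro g P
    refine le_antisymm (Ideal.map_le_iff_le_comap.2 fun x hx => ?_) fun x hx => ?_
    · rw [Ideal.mem_comap, Ideal.mem_comap, hinv₂]
      exact hx
    · rw [← hinv₁ g x]
      exact Ideal.mem_map_of_mem _ hx
  have hιle : ∀ g (P : Ideal (GLRing (↥kt) n)), Ideal.map ι I ≤ P →
      Ideal.map ι I ≤ P.comap (act g) := by
    intro g P hP
    rw [Ideal.map_le_iff_le_comap, Ideal.comap_comap, hactι]
    exact Ideal.map_le_iff_le_comap.1 hP
  have hdι : ∀ x, dGt (ι x) = ι (dR x) := by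
    refine GLRing.leibniz_ext ι (dGt.toLinearMap.toAddMonoidHom.comp ι.toAddMonoidHom)
      (ι.toAddMonoidHom.comp dR.toLinearMap.toAddMonoidHom) ?_ ?_ ?_ ?_
    · intro x y
      simp
    · intro x y
      simp
    · intro a
      change dGt (ι _) = ι (dR _)
      rw [hιc, hdGtc, hdRk, hιc, hdkt]
    · intro i j
      change dGt (ι _) = ι (dR _)
      rw [hιX, hdGtX, hdRX, Matrix.mul_apply, Matrix.mul_apply, map_sum]
      refine Finset.sum_congr rfl fun l _ => ?_
      rw [map_mul, hιX, Matrix.map_apply, Matrix.map_apply, hιc]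
  have hleib : ∀ x y, dGt (x * y) = x * dGt y + y * dGt x := fun x y => by
    simp
  have hJ : IsDiffIdeal (fun x => dGt x) (Ideal.map ι I) :=
    IsDiffIdeal.map ι (fun x => dR x) dGt.toLinearMap.toAddMonoidHom hleib hdι hI.2.1
  have hle : ∀ i, Ideal.map ι I ≤ Q i := fun i => (hQmin i).1.2
  have hirr : ∀ i j, Q i ≤ Q j → i = j := fun i j hij =>
    hQinj (le_antisymm hij ((hQmin j).2 ⟨hQprime i, hle i⟩ hij))
  have hQD : ∀ i, ∀ x ∈ Q i, dGt x ∈ Q i := fun i =>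
    IsDiffIdeal.of_iInf_eq hQprime hirr hQdecomp (fun x => dGt x) hleib hJ i
  have hcomap : ∀ i, (Q i).comap ι = I := by
    intro i
    refine hI.2.2 _ ?_ ?_ (Ideal.map_le_iff_le_comap.1 (hle i))
    · exact Ideal.comap_ne_top ι (hQprime i).ne_top
    · intro x hx
      rw [Ideal.mem_comap, ← hdι]
      exact hQD i _ hx
  have hprime : ∀ g i, ((Q i).comap (act g)).IsPrime := fun g i =>
    have := hQprime i
    inferInstance
  have hcomap_min : ∀ g i, (Q i).comap (act g) ∈ (Ideal.map ι I).minimalPrimes := by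
    intro g i
    refine ⟨⟨hprime g i, hιle g _ (hle i)⟩, fun P hP hPQ x hx => ?_⟩
    have := hP.1
    have h : Q i ≤ P.comap (act g⁻¹) := by
      refine (hQmin i).2 ⟨inferInstance, hιle _ _ hP.2⟩ fun y hy => ?_
      have := hPQ hy
      rwa [Ideal.mem_comap, hinv₁] at this
    have := h hx
    rwa [Ideal.mem_comap, hinv₂] at this
  refine ⟨hQD, fun i => ?_, fun ρ => ?_⟩
  · have := hQprime i
    have := hQprime 0
    obtain ⟨g, hg⟩ := exists_le_comap_of_comap_eq act hone hmul ι
      (GLRing.mem_range_of_fixed act hactX hactc ι hιX hιc)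
      ((hcomap i).trans (hcomap 0).symm)
    refine ⟨g⁻¹, ?_⟩
    rw [hmap, inv_inv]
    exact le_antisymm hg ((hcomap_min g 0).2 ⟨hQprime i, hle i⟩ hg)
  · rw [hmap]
    have h : (Finset.univ : Finset (Fin (s + 1))).inf Q ≤ (Q 0).comap (act ρ⁻¹) := by
      rw [Finset.inf_univ_eq_iInf, hQdecomp]
      exact hιle _ _ (hle 0)
    obtain ⟨j, -, hj⟩ := ((hprime ρ⁻¹ 0).inf_le').1 h
    exact ⟨j, le_antisymm ((hcomap_min ρ⁻¹ 0).2 ⟨hQprime j, hle j⟩ hj) hj⟩
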